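/- arXiv:2402.09317 — 7 statements merged into one kernel-verified Lean document; each statement's English description precedes it below -/
import Mathlib

section
/- Let T>0 and let (x̄,ξ̄,r̄) ∈ 𝒟(𝒮). Then (x,ξ) := 𝒮(x̄,ξ̄,r̄) is a càdlàg path on [0,T] with initial value (x̄₀,ξ̄₀), every component of ξ is non-decreasing, and the map u ↦ ((x̄_u,ξ̄_u), r̄_u) is a WM1-parametrisation of (x,ξ). -/
open Set Filter Topology

noncomputable section

/-- The left-limit function `y(t−)` of a path `y` with initial value `y0 = y(0−)`. -/
def pathMinus {ι : Type*} (y : ℝ → ι → ℝ) (y0 : ι → ℝ) (t : ℝ) : ι → ℝ :=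
  if t ≤ 0 then y0 else fun i => Function.leftLim (fun s => y s i) t

/-- The thick graph `G_y` of the path `y` on `[0,T]` with initial value `y0`. -/
def thickGraph {ι : Type*} (T : ℝ) (y : ℝ → ι → ℝ) (y0 : ι → ℝ) : Set ((ι → ℝ) × ℝ) :=
  {p | p.2 ∈ Set.Icc 0 T ∧ ∀ i, p.1 i ∈ Set.uIcc (pathMinus y y0 p.2 i) (y p.2 i)}

/-- The order relation on the thick graph `G_y`. -/
def graphLE {ι : Type*} (y : ℝ → ι → ℝ) (y0 : ι → ℝ) (p q : (ι → ℝ) × ℝ) : Prop :=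
  p.2 < q.2 ∨ (p.2 = q.2 ∧ ∀ i, |pathMinus y y0 p.2 i - p.1 i| ≤ |pathMinus y y0 p.2 i - q.1 i|)

/-- `(yh, rh)` restricted to `[0,1]` is a `WM1`-parametrisation of the path `y` on `[0,T]`
with initial value `y0`. -/
def IsWM1Param {ι : Type*} (T : ℝ) (y : ℝ → ι → ℝ) (y0 : ι → ℝ)
    (yh : ℝ → ι → ℝ) (rh : ℝ → ℝ) : Prop :=
  ContinuousOn yh (Set.Icc 0 1) ∧ ContinuousOn rh (Set.Icc 0 1) ∧
  (∀ u ∈ Set.Icc (0:ℝ) 1, (yh u, rh u) ∈ thickGraph T y y0) ∧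
  (∀ u ∈ Set.Icc (0:ℝ) 1, ∀ v ∈ Set.Icc (0:ℝ) 1, u ≤ v →
    graphLE y y0 (yh u, rh u) (yh v, rh v)) ∧
  yh 0 = y0 ∧ yh 1 = y T ∧ rh 0 = 0 ∧ rh 1 = T

/-- Generalised inverse time change `r_t = inf{v ∈ [0,1] : r̄(v) > t}`, with `inf ∅ = 1`. -/
def invTime (rb : ℝ → ℝ) (t : ℝ) : ℝ :=
  sInf (insert 1 {v : ℝ | v ∈ Set.Icc (0:ℝ) 1 ∧ t < rb v})

/-- A path is càdlàg on `[0,T]`: right-continuous on `[0,T)` with left limits on `(0,T]`. -/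
def IsCadlagOn {E : Type*} [TopologicalSpace E] (T : ℝ) (y : ℝ → E) : Prop :=
  (∀ t ∈ Set.Ico (0:ℝ) T, Tendsto y (𝓝[>] t) (𝓝 (y t))) ∧
  (∀ t ∈ Set.Ioc (0:ℝ) T, ∃ L, Tendsto y (𝓝[<] t) (𝓝 L))

/-- The domain `𝒟(𝒮)` of the unparametrisation map `𝒮`. -/
def InDomainS (T : ℝ) {d l : ℕ} (xb : ℝ → Fin d → ℝ) (ξb : ℝ → Fin l → ℝ) (rb : ℝ → ℝ) :
    Prop :=
  ContinuousOn xb (Set.Icc 0 1) ∧ ContinuousOn ξb (Set.Icc 0 1) ∧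
  ContinuousOn rb (Set.Icc 0 1) ∧
  (∀ i, MonotoneOn (fun u => ξb u i) (Set.Icc 0 1)) ∧ MonotoneOn rb (Set.Icc 0 1) ∧
  (∀ u ∈ Set.Icc (0:ℝ) 1, rb u ∈ Set.Icc 0 T) ∧ rb 0 = 0 ∧ rb 1 = T ∧
  (∀ a b : ℝ, 0 ≤ a → a ≤ b → b ≤ 1 → (∀ u ∈ Set.Icc a b, rb u = rb a) →
    ∀ i, MonotoneOn (fun u => xb u i) (Set.Icc a b) ∨ AntitoneOn (fun u => xb u i) (Set.Icc a b))

/-- The (combined) path `𝒮(x̄,ξ̄,r̄) = (x̄∘r, ξ̄∘r)` on `[0,T]`. -/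
def sPath {d l : ℕ} (xb : ℝ → Fin d → ℝ) (ξb : ℝ → Fin l → ℝ) (rb : ℝ → ℝ) (t : ℝ) :
    (Fin d ⊕ Fin l) → ℝ :=
  Sum.elim (xb (invTime rb t)) (ξb (invTime rb t))

end

section InvTime

variable {T : ℝ} {rb : ℝ → ℝ}

lemma bddBelow_invTime_set (rb : ℝ → ℝ) (t : ℝ) :
    BddBelow (insert 1 {v : ℝ | v ∈ Set.Icc (0:ℝ) 1 ∧ t < rb v}) := by
  refine ⟨0, ?_⟩
  rintro v (rfl | hv)
  · exact zero_le_one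
  · exact hv.1.1

lemma invTime_mem_Icc (rb : ℝ → ℝ) (t : ℝ) : invTime rb t ∈ Set.Icc (0:ℝ) 1 := by
  refine ⟨le_csInf (insert_nonempty _ _) ?_,
    csInf_le (bddBelow_invTime_set rb t) (mem_insert _ _)⟩
  rintro v (rfl | hv)
  · exact zero_le_one
  · exact hv.1.1

lemma invTime_le {t v : ℝ} (hv : v ∈ Set.Icc (0:ℝ) 1) (h : t < rb v) : invTime rb t ≤ v :=
  csInf_le (bddBelow_invTime_set rb t) (mem_insert_of_mem _ ⟨hv, h⟩)

lemma monotone_invTime (rb : ℝ → ℝ) : Monotone (invTime rb) := fun _ _ hst =>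
  csInf_le_csInf (bddBelow_invTime_set rb _) (insert_nonempty _ _)
    (insert_subset_insert fun _ hv => ⟨hv.1, hst.trans_lt hv.2⟩)

lemma lt_of_invTime_lt (hmono : MonotoneOn rb (Set.Icc 0 1)) {t u : ℝ}
    (hu : u ≤ 1) (h : invTime rb t < u) : t < rb u := by
  obtain ⟨v, hv, hvu⟩ := exists_lt_of_csInf_lt (insert_nonempty _ _) h
  rcases hv with rfl | hv
  · exact absurd hvu (not_lt.2 hu)
  · exact hv.2.trans_le (hmono hv.1 ⟨hv.1.1.trans hvu.le, hu⟩ hvu.le)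

lemma tendsto_invTime_right (hmono : MonotoneOn rb (Set.Icc 0 1)) (t : ℝ) :
    Tendsto (invTime rb) (𝓝[>] t) (𝓝 (invTime rb t)) := by
  refine tendsto_order.2 ⟨fun a ha => ?_, fun a ha => ?_⟩
  · filter_upwards [self_mem_nhdsWithin] with s hs
    exact ha.trans_le (monotone_invTime rb (le_of_lt hs))
  · rcases (invTime_mem_Icc rb t).2.eq_or_lt with h1 | h1
    · exact Eventually.of_forall fun s => ((invTime_mem_Icc rb s).2.trans h1.ge).trans_lt ha
    · obtain ⟨v, hv, hva⟩ := exists_between (lt_min h1 ha)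
      have hv1 : v ≤ 1 := hva.le.trans (min_le_left _ _)
      have htv := lt_of_invTime_lt hmono hv1 hv
      filter_upwards [nhdsWithin_le_nhds (Iio_mem_nhds htv)] with s hs
      exact (invTime_le ⟨(invTime_mem_Icc rb t).1.trans hv.le, hv1⟩ hs).trans_lt
        (hva.trans_le (min_le_right _ _))

lemma apply_invTime (hcont : ContinuousOn rb (Set.Icc 0 1))
    (hmono : MonotoneOn rb (Set.Icc 0 1)) (h0 : rb 0 = 0) (h1 : rb 1 = T)
    {t : ℝ} (ht : t ∈ Set.Icc 0 T) : rb (invTime rb t) = t := by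
  obtain ⟨hR0, hR1⟩ := invTime_mem_Icc rb t
  refine le_antisymm (le_of_not_gt fun h => ?_) (le_of_not_gt fun h => ?_)
  · obtain ⟨c, htc, hc⟩ := exists_between h
    obtain ⟨w, hw, rfl⟩ := intermediate_value_Icc hR0
      (hcont.mono (Icc_subset_Icc_right hR1)) ⟨by rw [h0]; exact ht.1.trans htc.le, hc.le⟩
    have := invTime_le ⟨hw.1, hw.2.trans hR1⟩ htc
    rw [le_antisymm hw.2 this] at hc
    exact hc.false
  · obtain ⟨w, hw, hwt⟩ := intermediate_value_Icc hR1
      (hcont.mono (Icc_subset_Icc_left hR0)) ⟨h.le, by rw [h1]; exact ht.2⟩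
    rcases hw.1.eq_or_lt with he | hlt
    · rw [he, hwt] at h
      exact h.false
    · exact (lt_of_invTime_lt hmono hw.2 hlt).ne' hwt

lemma leftLim_invTime_mem_Icc (rb : ℝ → ℝ) (t : ℝ) :
    Function.leftLim (invTime rb) t ∈ Set.Icc (0:ℝ) 1 :=
  isClosed_Icc.mem_of_tendsto ((monotone_invTime rb).tendsto_leftLim t)
    (Eventually.of_forall (invTime_mem_Icc rb))

lemma apply_leftLim_invTime (hcont : ContinuousOn rb (Set.Icc 0 1))
    (hmono : MonotoneOn rb (Set.Icc 0 1)) (h0 : rb 0 = 0) (h1 : rb 1 = T)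
    {t : ℝ} (ht : t ∈ Set.Ioc 0 T) : rb (Function.leftLim (invTime rb) t) = t := by
  have hlim : Tendsto (fun s => rb (invTime rb s)) (𝓝[<] t)
      (𝓝 (rb (Function.leftLim (invTime rb) t))) :=
    (hcont _ (leftLim_invTime_mem_Icc rb t)).tendsto.comp
      (tendsto_nhdsWithin_iff.2 ⟨(monotone_invTime rb).tendsto_leftLim t,
        Eventually.of_forall (invTime_mem_Icc rb)⟩)
  refine tendsto_nhds_unique hlim ((tendsto_nhdsWithin_of_tendsto_nhds tendsto_id).congr' ?_)
  filter_upwards [Ioo_mem_nhdsLT ht.1] with s hs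
  exact (apply_invTime hcont hmono h0 h1 ⟨hs.1.le, hs.2.le.trans ht.2⟩).symm

lemma leftLim_invTime_le {t u : ℝ} (hu : u ∈ Set.Icc (0:ℝ) 1) (h : rb u = t) :
    Function.leftLim (invTime rb) t ≤ u := by
  refine le_of_tendsto ((monotone_invTime rb).tendsto_leftLim t) ?_
  filter_upwards [self_mem_nhdsWithin] with s hs
  exact invTime_le hu (h ▸ hs)

/-- On `[0,T]`, the left limit of a continuous path composed with the inverse time change is its
value at the first time at which `rb` reaches `t`. -/
lemma exists_pathMinus_comp_invTime {ι : Type*} {z : ℝ → ι → ℝ}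
    (hz : ContinuousOn z (Set.Icc 0 1)) (hcont : ContinuousOn rb (Set.Icc 0 1))
    (hmono : MonotoneOn rb (Set.Icc 0 1)) (h0 : rb 0 = 0) (h1 : rb 1 = T)
    {t : ℝ} (ht : t ∈ Set.Icc 0 T) :
    ∃ a ∈ Set.Icc (0:ℝ) 1, pathMinus (fun s => z (invTime rb s)) (z 0) t = z a ∧ rb a = t ∧
      ∀ u ∈ Set.Icc (0:ℝ) 1, rb u = t → a ≤ u := by
  rcases ht.1.eq_or_lt with rfl | hpos
  · exact ⟨0, ⟨le_rfl, zero_le_one⟩, by simp [pathMinus], h0, fun u hu _ => hu.1⟩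
  · refine ⟨_, leftLim_invTime_mem_Icc rb t, ?_,
      apply_leftLim_invTime hcont hmono h0 h1 ⟨hpos, ht.2⟩, fun u hu h => leftLim_invTime_le hu h⟩
    have hlim : Tendsto (fun s => z (invTime rb s)) (𝓝[<] t)
        (𝓝 (z (Function.leftLim (invTime rb) t))) :=
      (hz _ (leftLim_invTime_mem_Icc rb t)).tendsto.comp
        (tendsto_nhdsWithin_iff.2 ⟨(monotone_invTime rb).tendsto_leftLim t,
          Eventually.of_forall (invTime_mem_Icc rb)⟩)
    rw [pathMinus, if_neg (not_le.2 hpos)]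
    funext i
    exact leftLim_eq_of_tendsto (tendsto_pi_nhds.1 hlim i)

lemma isCadlagOn_comp_invTime {E : Type*} [TopologicalSpace E] {z : ℝ → E}
    (hz : ContinuousOn z (Set.Icc 0 1)) (hmono : MonotoneOn rb (Set.Icc 0 1)) :
    IsCadlagOn T (fun t => z (invTime rb t)) := by
  refine ⟨fun t _ => ?_, fun t _ => ⟨z (Function.leftLim (invTime rb) t), ?_⟩⟩
  · exact (hz _ (invTime_mem_Icc rb t)).tendsto.comp
      (tendsto_nhdsWithin_iff.2 ⟨tendsto_invTime_right hmono t,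
        Eventually.of_forall (invTime_mem_Icc rb)⟩)
  · exact (hz _ (leftLim_invTime_mem_Icc rb t)).tendsto.comp
      (tendsto_nhdsWithin_iff.2 ⟨(monotone_invTime rb).tendsto_leftLim t,
        Eventually.of_forall (invTime_mem_Icc rb)⟩)

/-- If `z` is componentwise monotone wherever `rb` is constant, then `(z, rb)` is a
`WM1`-parametrisation of the path obtained by undoing the time change. -/
lemma isWM1Param_comp_invTime {ι : Type*} {z : ℝ → ι → ℝ}
    (hz : ContinuousOn z (Set.Icc 0 1)) (hcont : ContinuousOn rb (Set.Icc 0 1))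
    (hmono : MonotoneOn rb (Set.Icc 0 1)) (h0 : rb 0 = 0) (h1 : rb 1 = T)
    (hflat : ∀ a b : ℝ, 0 ≤ a → a ≤ b → b ≤ 1 → (∀ u ∈ Set.Icc a b, rb u = rb a) →
      ∀ i, MonotoneOn (fun u => z u i) (Set.Icc a b) ∨
        AntitoneOn (fun u => z u i) (Set.Icc a b)) :
    IsWM1Param T (fun t => z (invTime rb t)) (z 0) z rb := by
  have m0 : (0:ℝ) ∈ Set.Icc (0:ℝ) 1 := ⟨le_rfl, zero_le_one⟩
  have m1 : (1:ℝ) ∈ Set.Icc (0:ℝ) 1 := ⟨zero_le_one, le_rfl⟩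
  have hmem : ∀ u ∈ Set.Icc (0:ℝ) 1, rb u ∈ Set.Icc 0 T := fun u hu =>
    ⟨h0 ▸ hmono m0 hu hu.1, h1 ▸ hmono hu m1 hu.2⟩
  have hle : ∀ u ∈ Set.Icc (0:ℝ) 1, u ≤ invTime rb (rb u) := fun u hu =>
    le_of_not_gt fun h => (lt_of_invTime_lt hmono hu.2 h).false
  have hconst : ∀ a ∈ Set.Icc (0:ℝ) 1, ∀ b ∈ Set.Icc (0:ℝ) 1, rb a = rb b →
      ∀ w ∈ Set.Icc a b, rb w = rb a := fun a ha b hb hab w hw =>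
    have hw' : w ∈ Set.Icc (0:ℝ) 1 := ⟨ha.1.trans hw.1, hw.2.trans hb.2⟩
    le_antisymm (hab ▸ hmono hw' hb hw.2) (hmono ha hw' hw.1)
  refine ⟨hz, hcont, fun u hu => ⟨hmem u hu, fun i => ?_⟩, fun u hu v hv huv => ?_, rfl, ?_, h0, h1⟩
  · obtain ⟨a, ha, hpm, hra, hmin⟩ :=
      exists_pathMinus_comp_invTime hz hcont hmono h0 h1 (hmem u hu)
    have hau := hmin u hu rfl
    have hub := hle u hu
    have hb := invTime_mem_Icc rb (rb u)
    have hrb := apply_invTime hcont hmono h0 h1 (hmem u hu)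
    have ma : a ∈ Set.Icc a (invTime rb (rb u)) := ⟨le_rfl, hau.trans hub⟩
    have mu : u ∈ Set.Icc a (invTime rb (rb u)) := ⟨hau, hub⟩
    have mb : invTime rb (rb u) ∈ Set.Icc a (invTime rb (rb u)) := ⟨hau.trans hub, le_rfl⟩
    simp only [hpm]
    rcases hflat a _ ha.1 (hau.trans hub) hb.2
      (hconst a ha _ hb (hra.trans hrb.symm)) i with hm | hm
    · exact Set.mem_uIcc.2 (Or.inl ⟨hm ma mu hau, hm mu mb hub⟩)
    · exact Set.mem_uIcc.2 (Or.inr ⟨hm mu mb hub, hm ma mu hau⟩)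
  · rcases (hmono hu hv huv).lt_or_eq with hlt | heq
    · exact Or.inl hlt
    refine Or.inr ⟨heq, fun i => ?_⟩
    obtain ⟨a, ha, hpm, hra, hmin⟩ :=
      exists_pathMinus_comp_invTime hz hcont hmono h0 h1 (hmem u hu)
    have hau := hmin u hu rfl
    have ma : a ∈ Set.Icc a v := ⟨le_rfl, hau.trans huv⟩
    have mu : u ∈ Set.Icc a v := ⟨hau, huv⟩
    have mv : v ∈ Set.Icc a v := ⟨hau.trans huv, le_rfl⟩
    simp only [hpm]
    rcases hflat a v ha.1 (hau.trans huv) hv.2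
      (hconst a ha v hv (hra.trans heq)) i with hm | hm
    · have hau' := hm ma mu hau
      have huv' := hm mu mv huv
      simp only at hau' huv'
      rw [abs_of_nonpos (by linarith), abs_of_nonpos (by linarith)]
      linarith
    · have hau' := hm ma mu hau
      have huv' := hm mu mv huv
      simp only at hau' huv'
      rw [abs_of_nonneg (by linarith), abs_of_nonneg (by linarith)]
      linarith
  · have h := hle 1 m1
    rw [h1] at h
    simp only [le_antisymm (invTime_mem_Icc rb T).2 h]

end InvTime

/-- for `(x̄,ξ̄,r̄) ∈ 𝒟(𝒮)`, the path `(x,ξ) = 𝒮(x̄,ξ̄,r̄)` is càdlàg on `[0,T]`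
with initial value `(x̄₀,ξ̄₀)`, every component of `ξ` is non-decreasing, and
`u ↦ ((x̄_u,ξ̄_u), r̄_u)` is a `WM1`-parametrisation of `(x,ξ)`. -/
theorem stmt0 (T : ℝ) (hT : 0 < T) (d l : ℕ)
    (xb : ℝ → Fin d → ℝ) (ξb : ℝ → Fin l → ℝ) (rb : ℝ → ℝ)
    (hdom : InDomainS T xb ξb rb) :
    IsCadlagOn T (sPath xb ξb rb) ∧
    (∀ t : ℝ, t < 0 → sPath xb ξb rb t = Sum.elim (xb 0) (ξb 0)) ∧
    (∀ i, MonotoneOn (fun t => ξb (invTime rb t) i) (Set.Icc 0 T)) ∧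
    IsWM1Param T (sPath xb ξb rb) (Sum.elim (xb 0) (ξb 0))
      (fun u => Sum.elim (xb u) (ξb u)) rb := by
  obtain ⟨hx, hξ, hr, hξm, hrm, -, h0, h1, hflat⟩ := hdom
  have hz : ContinuousOn (fun u => Sum.elim (xb u) (ξb u)) (Set.Icc 0 1) := by
    refine continuousOn_pi.2 ?_
    rintro (i | i)
    · exact continuousOn_pi.1 hx i
    · exact continuousOn_pi.1 hξ i
  refine ⟨isCadlagOn_comp_invTime hz hrm, fun t ht => ?_, fun i s _ t _ hst => ?_,
    isWM1Param_comp_invTime hz hr hrm h0 h1 fun a b ha hab hb hc => ?_⟩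
  · have : invTime rb t = 0 :=
      le_antisymm (invTime_le ⟨le_rfl, zero_le_one⟩ (by rwa [h0])) (invTime_mem_Icc rb t).1
    rw [sPath, this]
  · exact hξm i (invTime_mem_Icc rb s) (invTime_mem_Icc rb t) (monotone_invTime rb hst)
  · rintro (i | i)
    · exact hflat a b ha hab hb hc i
    · exact Or.inl ((hξm i).mono (Icc_subset_Icc ha hb))
end

section
/- Let T>0 and let r̄:[0,1]→[0,T] be continuous and non-decreasing with r̄₀ = 0 and r̄₁ = T. Let μ_{r̄} denote the Lebesgue–Stieltjes measure of r̄ on [0,1]. Then the pushforward measure of μ_{r̄} under the map r̄ equals Lebesgue measure on [0,T]. -/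
open Set MeasureTheory

/-- the pushforward of the Lebesgue–Stieltjes measure of `r̄` under `r̄`
is Lebesgue measure on `[0,T]`. -/
theorem stmt3 (T : ℝ) (hT : 0 < T) (rb : ℝ → ℝ)
    (hcont : ContinuousOn rb (Set.Icc 0 1)) (hmono : MonotoneOn rb (Set.Icc 0 1))
    (hmem : ∀ v ∈ Set.Icc (0:ℝ) 1, rb v ∈ Set.Icc 0 T)
    (h0 : rb 0 = 0) (h1 : rb 1 = T)
    (μ : Measure ℝ)
    (hμ : ∀ a b : ℝ, 0 ≤ a → a ≤ b → b ≤ 1 → μ (Set.Icc a b) = ENNReal.ofReal (rb b - rb a))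
    (hsupp : μ (Set.Icc (0:ℝ) 1)ᶜ = 0) :
    μ.map rb = volume.restrict (Set.Icc 0 T) := by
  have hae : ∀ᵐ x ∂μ, x ∈ Icc (0 : ℝ) 1 := hsupp
  have hres : μ.restrict (Icc 0 1) = μ := Measure.restrict_eq_self_of_ae_mem hae
  have hmeas : AEMeasurable rb μ := by
    rw [← hres]
    exact hcont.aemeasurable measurableSet_Icc
  have hμuniv : μ univ = ENNReal.ofReal T := by
    rw [← hres, Measure.restrict_apply_univ, hμ 0 1 le_rfl zero_le_one le_rfl, h0, h1, sub_zero]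
  have : IsFiniteMeasure μ := ⟨by rw [hμuniv]; exact ENNReal.ofReal_lt_top⟩
  refine Measure.ext_of_Iic _ _ fun a => ?_
  rw [Measure.map_apply_of_aemeasurable hmeas measurableSet_Iic,
    Measure.restrict_apply measurableSet_Iic, ← Measure.measure_inter_eq_of_ae hae]
  rcases lt_or_ge a 0 with ha | ha
  · have hl : Icc 0 1 ∩ rb ⁻¹' Iic a = ∅ :=
      eq_empty_of_forall_notMem fun x hx => ((hmem x hx.1).1.trans hx.2).not_gt ha
    have hr : Iic a ∩ Icc 0 T = ∅ :=
      eq_empty_of_forall_notMem fun x hx => (hx.2.1.trans hx.1).not_gt ha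
    rw [hl, hr, measure_empty, measure_empty]
  · have hcompact : IsCompact (Icc (0 : ℝ) 1 ∩ rb ⁻¹' Iic a) :=
      isCompact_Icc.of_isClosed_subset
        (hcont.preimage_isClosed_of_isClosed isClosed_Icc isClosed_Iic) inter_subset_left
    obtain ⟨s, ⟨hs, hsa⟩, hsub⟩ := hcompact.exists_isGreatest
      ⟨0, left_mem_Icc.2 zero_le_one, by simpa [h0] using ha⟩
    have hpre : Icc (0 : ℝ) 1 ∩ rb ⁻¹' Iic a = Icc 0 s :=
      Subset.antisymm (fun x hx => ⟨hx.1.1, hsub hx⟩) fun x hx =>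
        have hx1 : x ∈ Icc (0 : ℝ) 1 := ⟨hx.1, hx.2.trans hs.2⟩
        ⟨hx1, (hmono hx1 hs hx.2).trans hsa⟩
    have hrs : rb s = min a T := by
      refine le_antisymm (le_min hsa (hmem s hs).2) ?_
      obtain ⟨c, hc, hca⟩ := intermediate_value_Icc zero_le_one hcont
        (show min a T ∈ Icc (rb 0) (rb 1) by
          rw [h0, h1]; exact ⟨le_min ha hT.le, min_le_right _ _⟩)
      rw [← hca]
      exact hmono hc hs (hsub ⟨hc, hca.trans_le (min_le_left _ _)⟩)
    have hvol : Iic a ∩ Icc 0 T = Icc 0 (min a T) := by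
      ext x; simp only [mem_inter_iff, mem_Iic, mem_Icc, le_min_iff]; tauto
    rw [hvol, Real.volume_Icc, ← hrs]
    have := hμ 0 s le_rfl hs.1 hs.2
    rw [h0, ← hpre] at this
    exact this
end

section
/- Let T>0, c>0 and let ρ:[0,T]→ℝ satisfy ρ(t) − ρ(s) ≥ c(t−s) for all 0 ≤ s ≤ t ≤ T. Define the generalised inverse ρ̄(v) := min( inf{t∈[0,T] : ρ(t) > v}, T ) for v∈ℝ (with inf ∅ := T). Then ρ̄ is Lipschitz continuous on ℝ with Lipschitz constant 1/c. -/
open Set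

/-- Generalised inverse `ρ̄(v) = min(inf{t ∈ [0,T] : ρ(t) > v}, T)`, with `inf ∅ = T`. -/
noncomputable def genInvT (T : ℝ) (ρ : ℝ → ℝ) (v : ℝ) : ℝ :=
  min (sInf (insert T {t : ℝ | t ∈ Set.Icc 0 T ∧ v < ρ t})) T

theorem genInvT_le_right (T : ℝ) (ρ : ℝ → ℝ) (v : ℝ) : genInvT T ρ v ≤ T :=
  min_le_right _ _

theorem genInvT_le_of_lt {T t v : ℝ} {ρ : ℝ → ℝ} (hT : 0 ≤ T) (ht : t ∈ Set.Icc 0 T)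
    (hv : v < ρ t) : genInvT T ρ v ≤ t := by
  refine (min_le_left _ _).trans (csInf_le ⟨0, ?_⟩ (Set.mem_insert_of_mem T ⟨ht, hv⟩))
  rintro s (rfl | hs)
  exacts [hT, hs.1.1]

theorem le_genInvT {T a v : ℝ} {ρ : ℝ → ℝ} (haT : a ≤ T)
    (h : ∀ t ∈ Set.Icc 0 T, v < ρ t → a ≤ t) : a ≤ genInvT T ρ v := by
  refine le_min (le_csInf (Set.insert_nonempty _ _) ?_) haT
  rintro t (rfl | ht)
  exacts [haT, h t ht.1 ht.2]

/-- if `ρ(t) − ρ(s) ≥ c(t−s)` on `[0,T]`, its generalised inverse is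
`(1/c)`-Lipschitz on ℝ. -/
theorem stmt5 (T c : ℝ) (hT : 0 < T) (hc : 0 < c) (ρ : ℝ → ℝ)
    (hρ : ∀ s t : ℝ, 0 ≤ s → s ≤ t → t ≤ T → c * (t - s) ≤ ρ t - ρ s) :
    LipschitzWith (Real.toNNReal (1 / c)) (genInvT T ρ) := by
  refine LipschitzWith.of_le_add_mul' _ fun x y => ?_
  have hd : 0 ≤ 1 / c * dist x y := by positivity
  rw [← sub_le_iff_le_add]
  refine le_genInvT (by linarith [genInvT_le_right T ρ x]) fun t ht hy => ?_
  rw [sub_le_iff_le_add]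
  rcases le_total T (t + 1 / c * dist x y) with h | h
  · exact (genInvT_le_right T ρ x).trans h
  · refine genInvT_le_of_lt hT.le ⟨add_nonneg ht.1 hd, h⟩ ?_
    have hinc := hρ t (t + 1 / c * dist x y) ht.1 (by linarith) h
    have hcancel : c * (t + 1 / c * dist x y - t) = dist x y := by field_simp; ring
    have hxy : x - y ≤ dist x y := le_abs_self _
    linarith
end

section
/- Let T>0 and let ξ:[0,T]→ℝ^l be continuous with each component non-decreasing and ξ₀ = 0. Set V_t := Σ_{i=1}^l ξ^i_t, r_t := (t + arctan V_t)/(T + π/2) for t∈[0,T], and r̄_v := min( inf{t∈[0,T] : r_t > v}, T ) for v∈[0,1]. Then for all u,v∈[0,1]: |r̄_u − r̄_v| + |arctan(V_{r̄_u}) − arctan(V_{r̄_v})| ≤ (T + π/2)|u−v|. Moreover, if K>0 and V_T ≤ K, then ξ̄ := ξ∘r̄ : [0,1]→ℝ^l is Lipschitz continuous with constant (1+K²)(T+π/2). -/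
open Set

/-- Euclidean norm on `ι → ℝ`. -/
noncomputable def eucNorm {ι : Type*} [Fintype ι] (a : ι → ℝ) : ℝ :=
  Real.sqrt (∑ i, a i ^ 2)

/-- The time change `r_t = (t + arctan V_t)/(T + π/2)`, where `V_t = Σ_i ξ^i_t`. -/
noncomputable def tc (T : ℝ) {l : ℕ} (ξ : ℝ → Fin l → ℝ) (t : ℝ) : ℝ :=
  (t + Real.arctan (∑ i, ξ t i)) / (T + Real.pi / 2)

/-- Its generalised inverse `r̄_v = min(inf{t ∈ [0,T] : r_t > v}, T)`, with `inf ∅ = T`. -/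
noncomputable def tcInv (T : ℝ) {l : ℕ} (ξ : ℝ → Fin l → ℝ) (v : ℝ) : ℝ :=
  min (sInf (insert T {t : ℝ | t ∈ Set.Icc 0 T ∧ v < tc T ξ t})) T

section TimeChange

variable {T : ℝ} {l : ℕ} {ξ : ℝ → Fin l → ℝ}

theorem eucNorm_le_sum {ι : Type*} [Fintype ι] {a : ι → ℝ} (ha : ∀ i, 0 ≤ a i) :
    eucNorm a ≤ ∑ i, a i :=
  Real.sqrt_le_iff.2 ⟨Finset.sum_nonneg fun i _ => ha i,
    Finset.sum_sq_le_sq_sum_of_nonneg fun i _ => ha i⟩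

theorem eucNorm_sub_comm {ι : Type*} [Fintype ι] (a b : ι → ℝ) :
    eucNorm (a - b) = eucNorm (b - a) := by
  simp only [eucNorm, Pi.sub_apply, sub_sq_comm]

theorem sub_le_mul_arctan_sub {K x y : ℝ} (hx : 0 ≤ x) (hxy : x ≤ y) (hy : y ≤ K) :
    y - x ≤ (1 + K ^ 2) * (Real.arctan y - Real.arctan x) := by
  have hderiv (z : ℝ) : HasDerivAt (fun z => (1 + K ^ 2) * Real.arctan z - z)
      ((1 + K ^ 2) * (1 / (1 + z ^ 2)) - 1) z :=
    ((Real.hasDerivAt_arctan z).const_mul _).sub (hasDerivAt_id z)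
  have hmono : MonotoneOn (fun z => (1 + K ^ 2) * Real.arctan z - z) (Icc 0 K) := by
    refine monotoneOn_of_deriv_nonneg (convex_Icc 0 K)
      (fun z _ => (hderiv z).continuousAt.continuousWithinAt)
      (fun z _ => (hderiv z).differentiableAt.differentiableWithinAt) fun z hz => ?_
    rw [interior_Icc] at hz
    rw [(hderiv z).deriv, mul_one_div, sub_nonneg, one_le_div (by positivity)]
    nlinarith [hz.1, hz.2]
  have h := hmono ⟨hx, hxy.trans hy⟩ ⟨hx.trans hxy, hy⟩ hxy
  simp only at h
  linarith

theorem monotoneOn_sum_apply (hmono : ∀ i, MonotoneOn (fun t => ξ t i) (Icc 0 T)) :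
    MonotoneOn (fun t => ∑ i, ξ t i) (Icc 0 T) :=
  fun _ hs _ ht hst => Finset.sum_le_sum fun i _ => hmono i hs ht hst

theorem strictMonoOn_tc (hT : 0 < T) (hmono : ∀ i, MonotoneOn (fun t => ξ t i) (Icc 0 T)) :
    StrictMonoOn (tc T ξ) (Icc 0 T) := by
  intro s hs t ht hst
  have harctan := Real.arctan_strictMono.monotone (monotoneOn_sum_apply hmono hs ht hst.le)
  have hpos : 0 < T + Real.pi / 2 := by positivity
  exact div_lt_div_of_pos_right (add_lt_add_of_lt_of_le hst harctan) hpos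

theorem continuousOn_tc (hcont : ContinuousOn ξ (Icc 0 T)) :
    ContinuousOn (tc T ξ) (Icc 0 T) := by
  have hsum : ContinuousOn (fun t => ∑ i, ξ t i) (Icc 0 T) :=
    continuousOn_finsetSum _ fun i _ => continuousOn_pi.1 hcont i
  exact (continuousOn_id.add (Real.continuous_arctan.comp_continuousOn hsum)).div_const _

theorem tcInv_mem_Icc_and_tc_tcInv (hT : 0 < T) (hcont : ContinuousOn ξ (Icc 0 T))
    (hmono : ∀ i, MonotoneOn (fun t => ξ t i) (Icc 0 T)) (h0 : ξ 0 = 0) {v : ℝ} (hv : 0 ≤ v) :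
    tcInv T ξ v ∈ Icc 0 T ∧ tc T ξ (tcInv T ξ v) = min v (tc T ξ T) := by
  have hstrict := strictMonoOn_tc hT hmono
  have hT_mem : T ∈ Icc 0 T := right_mem_Icc.2 hT.le
  rcases le_or_gt (tc T ξ T) v with hle | hlt
  · have hempty : {t : ℝ | t ∈ Icc 0 T ∧ v < tc T ξ t} = ∅ :=
      eq_empty_of_forall_notMem fun t ht =>
        (((hstrict.monotoneOn ht.1 hT_mem ht.1.2).trans hle).trans_lt ht.2).false
    have hinv : tcInv T ξ v = T := by rw [tcInv, hempty]; simp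
    rw [hinv, min_eq_right hle]
    exact ⟨hT_mem, rfl⟩
  · have hzero : tc T ξ 0 = 0 := by simp [tc, h0]
    obtain ⟨t, ht, rfl⟩ := intermediate_value_Icc hT.le (continuousOn_tc hcont)
      ⟨hzero.trans_le hv, hlt.le⟩
    have htT : t < T := (hstrict.lt_iff_lt ht hT_mem).1 hlt
    have hset : insert T {s : ℝ | s ∈ Icc 0 T ∧ tc T ξ t < tc T ξ s} = Ioc t T := by
      ext s
      constructor
      · rintro (rfl | ⟨hs, hts⟩)
        · exact right_mem_Ioc.2 htT
        · exact ⟨(hstrict.lt_iff_lt ht hs).1 hts, hs.2⟩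
      · intro hs
        have hs' : s ∈ Icc 0 T := ⟨ht.1.trans hs.1.le, hs.2⟩
        exact Or.inr ⟨hs', hstrict ht hs' hs.1⟩
    have hinv : tcInv T ξ (tc T ξ t) = t := by
      rw [tcInv, hset, csInf_Ioc htT, min_eq_left htT.le]
    rw [hinv, min_eq_left hlt.le]
    exact ⟨ht, rfl⟩

theorem tcInv_le_and_sub_add_arctan_sub_le (hT : 0 < T) (hcont : ContinuousOn ξ (Icc 0 T))
    (hmono : ∀ i, MonotoneOn (fun t => ξ t i) (Icc 0 T)) (h0 : ξ 0 = 0)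
    {u v : ℝ} (hu : 0 ≤ u) (huv : u ≤ v) :
    tcInv T ξ u ≤ tcInv T ξ v ∧
      (tcInv T ξ v - tcInv T ξ u) + (Real.arctan (∑ i, ξ (tcInv T ξ v) i) -
        Real.arctan (∑ i, ξ (tcInv T ξ u) i)) ≤ (T + Real.pi / 2) * (v - u) := by
  obtain ⟨hmem_u, htc_u⟩ := tcInv_mem_Icc_and_tc_tcInv hT hcont hmono h0 hu
  obtain ⟨hmem_v, htc_v⟩ := tcInv_mem_Icc_and_tc_tcInv hT hcont hmono h0 (hu.trans huv)
  have hpos : 0 < T + Real.pi / 2 := by positivity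
  constructor
  · rw [← (strictMonoOn_tc hT hmono).le_iff_le hmem_u hmem_v, htc_u, htc_v]
    exact min_le_min_right _ huv
  · have hclamp : tc T ξ (tcInv T ξ v) - tc T ξ (tcInv T ξ u) ≤ v - u := by
      rw [htc_u, htc_v]
      rcases min_cases u (tc T ξ T) with h | h <;>
        rcases min_cases v (tc T ξ T) with h' | h' <;> linarith
    rw [tc, tc, ← sub_div, div_le_iff₀ hpos] at hclamp
    linarith

end TimeChange

/-- the arctan time-change estimates and the Lipschitz bound for `ξ∘r̄`. -/
theorem stmt6 (T : ℝ) (hT : 0 < T) (l : ℕ) (ξ : ℝ → Fin l → ℝ)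
    (hcont : ContinuousOn ξ (Set.Icc 0 T))
    (hmono : ∀ i, MonotoneOn (fun t => ξ t i) (Set.Icc 0 T))
    (h0 : ξ 0 = 0) :
    (∀ u ∈ Set.Icc (0:ℝ) 1, ∀ v ∈ Set.Icc (0:ℝ) 1,
      |tcInv T ξ u - tcInv T ξ v| +
        |Real.arctan (∑ i, ξ (tcInv T ξ u) i) - Real.arctan (∑ i, ξ (tcInv T ξ v) i)| ≤
        (T + Real.pi / 2) * |u - v|) ∧
    (∀ K : ℝ, 0 < K → (∑ i, ξ T i) ≤ K →
      ∀ u ∈ Set.Icc (0:ℝ) 1, ∀ v ∈ Set.Icc (0:ℝ) 1,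
        eucNorm (ξ (tcInv T ξ u) - ξ (tcInv T ξ v)) ≤
          (1 + K ^ 2) * (T + Real.pi / 2) * |u - v|) := by
  constructor
  · intro u hu v hv
    wlog huv : u ≤ v generalizing u v
    · have h := this v hv u hu (le_of_not_ge huv)
      rwa [abs_sub_comm (tcInv T ξ v), abs_sub_comm (Real.arctan _), abs_sub_comm v] at h
    obtain ⟨hle, hsum⟩ := tcInv_le_and_sub_add_arctan_sub_le hT hcont hmono h0 hu.1 huv
    have harctan := Real.arctan_strictMono.monotone <| monotoneOn_sum_apply hmono
      (tcInv_mem_Icc_and_tc_tcInv hT hcont hmono h0 hu.1).1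
      (tcInv_mem_Icc_and_tc_tcInv hT hcont hmono h0 hv.1).1 hle
    rwa [abs_sub_comm, abs_of_nonneg (sub_nonneg.2 hle), abs_sub_comm (Real.arctan _),
      abs_of_nonneg (sub_nonneg.2 harctan), abs_sub_comm u, abs_of_nonneg (sub_nonneg.2 huv)]
  · intro K _ hVK u hu v hv
    wlog huv : u ≤ v generalizing u v
    · have h := this v hv u hu (le_of_not_ge huv)
      rwa [eucNorm_sub_comm, abs_sub_comm] at h
    obtain ⟨hle, hsum⟩ := tcInv_le_and_sub_add_arctan_sub_le hT hcont hmono h0 hu.1 huv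
    have hmem_u := (tcInv_mem_Icc_and_tc_tcInv hT hcont hmono h0 hu.1).1
    have hmem_v := (tcInv_mem_Icc_and_tc_tcInv hT hcont hmono h0 hv.1).1
    have hV := monotoneOn_sum_apply hmono
    have hV_nonneg : 0 ≤ ∑ i, ξ (tcInv T ξ u) i := by
      simpa [h0] using hV (left_mem_Icc.2 hT.le) hmem_u hmem_u.1
    have hV_le : ∑ i, ξ (tcInv T ξ v) i ≤ K :=
      (hV hmem_v (right_mem_Icc.2 hT.le) hmem_v.2).trans hVK
    rw [eucNorm_sub_comm, abs_sub_comm, abs_of_nonneg (sub_nonneg.2 huv)]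
    calc eucNorm (ξ (tcInv T ξ v) - ξ (tcInv T ξ u))
        ≤ ∑ i, (ξ (tcInv T ξ v) - ξ (tcInv T ξ u)) i :=
          eucNorm_le_sum fun i => sub_nonneg.2 (hmono i hmem_u hmem_v hle)
      _ = ∑ i, ξ (tcInv T ξ v) i - ∑ i, ξ (tcInv T ξ u) i := by
          simp only [Pi.sub_apply, Finset.sum_sub_distrib]
      _ ≤ (1 + K ^ 2) * (Real.arctan (∑ i, ξ (tcInv T ξ v) i) -
            Real.arctan (∑ i, ξ (tcInv T ξ u) i)) :=
          sub_le_mul_arctan_sub hV_nonneg (hV hmem_u hmem_v hle) hV_le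
      _ ≤ (1 + K ^ 2) * ((T + Real.pi / 2) * (v - u)) := by
          gcongr
          linarith
      _ = (1 + K ^ 2) * (T + Real.pi / 2) * (v - u) := by ring
end

section
/- Let M>0, ε>0 and let h:[0,1]→[0,M] be continuous and non-decreasing. Define β_u := (u + ε h_u)/(1 + εM) for u∈[0,1] and β̄_v := min( inf{u∈[0,1] : β_u > v}, 1 ) for v∈[0,1]. Then: (i) β̄ is Lipschitz continuous with constant 1+εM; (ii) h∘β̄ is Lipschitz continuous with constant (1+εM)/ε; (iii) |β̄_u − u| ≤ 2εM for all u∈[0,1]. -/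
open Set

/-- Generalised inverse `β̄(v) = min(inf{u ∈ [0,1] : β(u) > v}, 1)`, with `inf ∅ = 1`. -/
noncomputable def genInv01 (β : ℝ → ℝ) (v : ℝ) : ℝ :=
  min (sInf (insert 1 {u : ℝ | u ∈ Set.Icc (0:ℝ) 1 ∧ v < β u})) 1

/-- A strictly increasing `β` takes at `w` the value `v` clamped to `[β 0, β 1]` only if `w` is the
generalised inverse of `β` at `v`. -/
theorem genInv01_eq_of_eq_clamp {β : ℝ → ℝ} (hβ : StrictMonoOn β (Icc 0 1)) {v w : ℝ}
    (hw : w ∈ Icc (0 : ℝ) 1) (hwv : β w = max (β 0) (min v (β 1))) : genInv01 β v = w := by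
  have h0 : (0 : ℝ) ∈ Icc (0 : ℝ) 1 := by simp
  have h1 : (1 : ℝ) ∈ Icc (0 : ℝ) 1 := by simp
  have hglb : IsGLB (insert 1 {u : ℝ | u ∈ Icc (0 : ℝ) 1 ∧ v < β u}) w := by
    refine ⟨?_, fun b hb => le_of_forall_gt_imp_ge_of_dense fun x hx => ?_⟩
    · rintro u (rfl | ⟨hu, hvu⟩)
      · exact hw.2
      · by_contra! huw
        have hlt := hβ hu hw huw
        have hle := hβ.monotoneOn h0 hu hu.1
        rw [hwv] at hlt
        rcases lt_max_iff.1 hlt with h | h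
        · exact h.not_ge hle
        · exact hvu.not_gt (lt_min_iff.1 h).1
    · rcases le_or_gt 1 x with hx1 | hx1
      · exact (hb (mem_insert _ _)).trans hx1
      · have hxm : x ∈ Icc (0 : ℝ) 1 := ⟨hw.1.trans hx.le, hx1.le⟩
        have hwx := hβ hw hxm hx
        have hx1' := hβ hxm h1 hx1
        rw [hwv] at hwx
        refine hb (mem_insert_of_mem _ ⟨hxm, ?_⟩)
        rcases min_lt_iff.1 ((le_max_right _ _).trans_lt hwx) with h | h
        · exact h
        · exact absurd h hx1'.not_gt
  rw [genInv01, hglb.csInf_eq (insert_nonempty _ _), min_eq_left hw.2]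

/-- For a continuous strictly increasing `β`, the generalised inverse is a point of `[0, 1]` at which
`β` takes the value `v` clamped to `[β 0, β 1]`. -/
theorem genInv01_mem_and_apply {β : ℝ → ℝ} (hβ : StrictMonoOn β (Icc 0 1))
    (hc : ContinuousOn β (Icc 0 1)) (v : ℝ) :
    genInv01 β v ∈ Icc (0 : ℝ) 1 ∧ β (genInv01 β v) = max (β 0) (min v (β 1)) := by
  have h01 : β 0 ≤ β 1 := hβ.monotoneOn (by simp) (by simp) zero_le_one
  obtain ⟨w, hw, hwv⟩ := intermediate_value_Icc zero_le_one hc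
    (show max (β 0) (min v (β 1)) ∈ Icc (β 0) (β 1) from
      ⟨le_max_left _ _, max_le h01 (min_le_right _ _)⟩)
  rw [genInv01_eq_of_eq_clamp hβ hw hwv]
  exact ⟨hw, hwv⟩

/-- Clamping to an interval does not increase distances. -/
theorem abs_clamp_sub_clamp_le (a b u v : ℝ) :
    |max a (min u b) - max a (min v b)| ≤ |u - v| :=
  calc |max a (min u b) - max a (min v b)| ≤ |min u b - min v b| := by
        simpa using abs_max_sub_max_le_max a (min u b) a (min v b)
    _ ≤ |u - v| := by simpa using abs_min_sub_min_le_max u b v b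

/-- Both terms of a sum of two non-decreasing functions vary at most as much as the sum. -/
theorem abs_sub_add_abs_sub_of_monotoneOn {s : Set ℝ} {h : ℝ → ℝ} (hmono : MonotoneOn h s)
    {ε : ℝ} (hε : 0 ≤ ε) {a b : ℝ} (ha : a ∈ s) (hb : b ∈ s) :
    |a - b| + ε * |h a - h b| = |(a + ε * h a) - (b + ε * h b)| := by
  wlog hab : a ≤ b generalizing a b
  · rw [abs_sub_comm a, abs_sub_comm (h a), abs_sub_comm (a + _)]
    exact this hb ha (le_of_not_ge hab)
  have hh := hmono ha hb hab
  have hεh := mul_le_mul_of_nonneg_left hh hε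
  rw [abs_of_nonpos (by linarith), abs_of_nonpos (by linarith), abs_of_nonpos (by linarith)]
  ring

/-- reparametrisation estimates for `β(u) = (u + ε h(u))/(1 + εM)`. -/
theorem stmt7 (M ε : ℝ) (hM : 0 < M) (hε : 0 < ε) (h : ℝ → ℝ)
    (hcont : ContinuousOn h (Set.Icc 0 1)) (hmono : MonotoneOn h (Set.Icc 0 1))
    (hrange : ∀ u ∈ Set.Icc (0:ℝ) 1, h u ∈ Set.Icc 0 M) :
    (∀ u ∈ Set.Icc (0:ℝ) 1, ∀ v ∈ Set.Icc (0:ℝ) 1,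
        |genInv01 (fun w => (w + ε * h w) / (1 + ε * M)) u -
          genInv01 (fun w => (w + ε * h w) / (1 + ε * M)) v| ≤ (1 + ε * M) * |u - v|) ∧
    (∀ u ∈ Set.Icc (0:ℝ) 1, ∀ v ∈ Set.Icc (0:ℝ) 1,
        |h (genInv01 (fun w => (w + ε * h w) / (1 + ε * M)) u) -
          h (genInv01 (fun w => (w + ε * h w) / (1 + ε * M)) v)| ≤
          ((1 + ε * M) / ε) * |u - v|) ∧
    (∀ u ∈ Set.Icc (0:ℝ) 1,
        |genInv01 (fun w => (w + ε * h w) / (1 + ε * M)) u - u| ≤ 2 * ε * M) := by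
  set β : ℝ → ℝ := fun w => (w + ε * h w) / (1 + ε * M)
  have hεM : 0 < ε * M := mul_pos hε hM
  have hK : 0 < 1 + ε * M := by linarith
  have hβ : StrictMonoOn β (Icc 0 1) := fun a ha b hb hab =>
    div_lt_div_of_pos_right
      (add_lt_add_of_lt_of_le hab (mul_le_mul_of_nonneg_left (hmono ha hb hab.le) hε.le)) hK
  have hc : ContinuousOn β (Icc 0 1) :=
    (continuousOn_id.add (continuousOn_const.mul hcont)).div_const _
  have hmul (w : ℝ) : (1 + ε * M) * β w = w + ε * h w := mul_div_cancel₀ _ hK.ne'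
  have hmem (v : ℝ) := (genInv01_mem_and_apply hβ hc v).1
  have happ (v : ℝ) := (genInv01_mem_and_apply hβ hc v).2
  have key (u v : ℝ) : |genInv01 β u - genInv01 β v| +
      ε * |h (genInv01 β u) - h (genInv01 β v)| ≤ (1 + ε * M) * |u - v| := by
    rw [abs_sub_add_abs_sub_of_monotoneOn hmono hε.le (hmem u) (hmem v), ← hmul, ← hmul,
      ← mul_sub, abs_mul, abs_of_pos hK, happ, happ]
    exact mul_le_mul_of_nonneg_left (abs_clamp_sub_clamp_le _ _ _ _) hK.le
  refine ⟨fun u _ v _ => ?_, fun u _ v _ => ?_, fun u hu => ?_⟩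
  · have := mul_nonneg hε.le (abs_nonneg (h (genInv01 β u) - h (genInv01 β v)))
    linarith [key u v]
  · rw [div_mul_eq_mul_div, le_div_iff₀ hε, mul_comm _ ε]
    linarith [key u v, abs_nonneg (genInv01 β u - genInv01 β v)]
  · have hβw (w : ℝ) (hw : w ∈ Icc (0 : ℝ) 1) : |β w - w| ≤ ε * M := by
      have hlo := mul_nonneg hε.le (hrange w hw).1
      have hhi := mul_le_mul_of_nonneg_left (hrange w hw).2 hε.le
      have hwlo := mul_nonneg hεM.le hw.1
      have hwhi := mul_le_mul_of_nonneg_left hw.2 hεM.le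
      have hle : |(1 + ε * M) * (β w - w)| ≤ ε * M := by
        rw [mul_sub, hmul, abs_le]
        constructor <;> linarith
      rw [abs_mul, abs_of_pos hK] at hle
      linarith [mul_nonneg hεM.le (abs_nonneg (β w - w))]
    have h0 := abs_le.1 (hβw 0 (by simp))
    have h1 := abs_le.1 (hβw 1 (by simp))
    have hclamp : |max (β 0) (min u (β 1)) - u| ≤ ε * M := by
      have hlo : u - ε * M ≤ min u (β 1) := le_min (by linarith) (by linarith [hu.2])
      have hhi : max (β 0) (min u (β 1)) ≤ u + ε * M :=
        max_le (by linarith [hu.1]) ((min_le_left _ _).trans (by linarith))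
      have hle := le_max_right (β 0) (min u (β 1))
      rw [abs_le]
      constructor <;> linarith
    have hdist := abs_sub_le (genInv01 β u) (β (genInv01 β u)) u
    rw [abs_sub_comm _ (β _)] at hdist
    have hg := hβw _ (hmem u)
    rw [← happ] at hclamp
    linarith
end

section
/- Let T>0 and let γ:[0,T]×ℝ^d×ℝ^l→ℝ^{d×l} be continuous and bounded. For each n∈ℕ let a^n:[0,1]→[0,T] and y^n:[0,1]→ℝ^d be continuous, let z^n:[0,1]→ℝ^l be continuous with each component non-decreasing, and suppose y^n_u = y^n_0 + ∫₀^u γ(a^n_v, y^n_v, z^n_v) dz^n_v for all u∈[0,1]. If (a^n, y^n, z^n) converges uniformly on [0,1] to (a, y, z) (so z is continuous with non-decreasing components), then y_u = y_0 + ∫₀^u γ(a_v, y_v, z_v) dz_v for all u∈[0,1]. -/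
open Set Filter MeasureTheory Topology

/-- `μ` is the Lebesgue–Stieltjes measure on `[0,1]` of the (continuous, non-decreasing)
function `z`. -/
def IsLSMeasureOn01 (z : ℝ → ℝ) (μ : Measure ℝ) : Prop :=
  (∀ a b : ℝ, 0 ≤ a → a ≤ b → b ≤ 1 → μ (Set.Icc a b) = ENNReal.ofReal (z b - z a)) ∧
  μ (Set.Icc (0:ℝ) 1)ᶜ = 0

lemma IsLSMeasureOn01.isFiniteMeasure {z : ℝ → ℝ} {μ : Measure ℝ} (h : IsLSMeasureOn01 z μ) :
    IsFiniteMeasure μ := by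
  refine ⟨?_⟩
  rw [← measure_add_measure_compl (measurableSet_Icc (a := (0 : ℝ)) (b := 1)), h.2,
    h.1 0 1 le_rfl zero_le_one le_rfl]
  simp

lemma IsLSMeasureOn01.nullSingletonClass {z : ℝ → ℝ} {μ : Measure ℝ} (h : IsLSMeasureOn01 z μ) :
    NullSingletonClass μ := by
  refine ⟨fun x => ?_⟩
  by_cases hx : x ∈ Icc (0 : ℝ) 1
  · simpa using h.1 x x hx.1 le_rfl hx.2
  · exact measure_mono_null (singleton_subset_iff.2 hx) h.2

lemma IsLSMeasureOn01.tendsto_real_Icc {z : ℕ → ℝ → ℝ} {z' : ℝ → ℝ} {μ : ℕ → Measure ℝ}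
    {μ' : Measure ℝ} (h : ∀ n, IsLSMeasureOn01 (z n) (μ n)) (h' : IsLSMeasureOn01 z' μ')
    (hz : ∀ u ∈ Icc (0 : ℝ) 1, Tendsto (fun n => z n u) atTop (𝓝 (z' u)))
    {a b : ℝ} (ha : 0 ≤ a) (hab : a ≤ b) (hb : b ≤ 1) :
    Tendsto (fun n => (μ n).real (Icc a b)) atTop (𝓝 (μ'.real (Icc a b))) := by
  simp only [Measure.real, h'.1 a b ha hab hb, fun n => (h n).1 a b ha hab hb]
  refine (ENNReal.tendsto_toReal ENNReal.ofReal_ne_top).comp (ENNReal.tendsto_ofReal ?_)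
  exact (hz b ⟨ha.trans hab, hb⟩).sub (hz a ⟨ha, hab.trans hb⟩)

/-- Riemann sums approximate the integral with respect to a finite atomless measure, with an error
controlled by the oscillation of the integrand on the cells of the partition. -/
lemma norm_integral_Icc_sub_riemannSum_le {E : Type*} [NormedAddCommGroup E]
    [NormedSpace ℝ E] [CompleteSpace E] (μ : Measure ℝ) [IsFiniteMeasure μ]
    [NullSingletonClass μ] {f : ℝ → E} {t : ℕ → ℝ} (ht : Monotone t) (N : ℕ) {ε : ℝ}
    (hf : ContinuousOn f (Icc (t 0) (t N)))
    (hosc : ∀ i < N, ∀ v ∈ Icc (t i) (t (i + 1)), ‖f v - f (t i)‖ ≤ ε) :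
    ‖(∫ v in Icc (t 0) (t N), f v ∂μ)
        - ∑ i ∈ Finset.range N, μ.real (Icc (t i) (t (i + 1))) • f (t i)‖
      ≤ ε * μ.real (Icc (t 0) (t N)) := by
  have hsub : ∀ i < N, Icc (t i) (t (i + 1)) ⊆ Icc (t 0) (t N) := fun i hi =>
    Icc_subset_Icc (ht (Nat.zero_le i)) (ht hi)
  have hint : ∀ i < N, IntegrableOn f (Icc (t i) (t (i + 1))) μ := fun i hi =>
    (hf.mono (hsub i hi)).integrableOn_compact isCompact_Icc
  have hsum : ∫ v in Icc (t 0) (t N), f v ∂μ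
      = ∑ i ∈ Finset.range N, ∫ v in Icc (t i) (t (i + 1)), f v ∂μ := by
    simp_rw [integral_Icc_eq_integral_Ioc]
    rw [← intervalIntegral.integral_of_le (ht (Nat.zero_le N)),
      ← intervalIntegral.sum_integral_adjacent_intervals]
    · exact Finset.sum_congr rfl fun i _ => intervalIntegral.integral_of_le (ht i.le_succ)
    · intro i hi
      rw [intervalIntegrable_iff_integrableOn_Icc_of_le (ht i.le_succ)]
      exact hint i hi
  have hmeas : μ.real (Icc (t 0) (t N))
      = ∑ i ∈ Finset.range N, μ.real (Icc (t i) (t (i + 1))) := by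
    have h1 : ∀ a b : ℝ, μ.real (Icc a b) = ∫ _ in Ioc a b, (1 : ℝ) ∂μ := fun a b => by
      rw [← integral_Icc_eq_integral_Ioc]; simp
    simp_rw [h1]
    rw [← intervalIntegral.integral_of_le (ht (Nat.zero_le N)),
      ← intervalIntegral.sum_integral_adjacent_intervals]
    · exact Finset.sum_congr rfl fun i _ => intervalIntegral.integral_of_le (ht i.le_succ)
    · intro i _
      exact intervalIntegrable_const
  rw [hsum, ← Finset.sum_sub_distrib, hmeas, Finset.mul_sum]
  refine norm_sum_le_of_le _ fun i hi => ?_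
  rw [Finset.mem_range] at hi
  rw [← setIntegral_const, ← integral_sub (hint i hi) (integrable_const _)]
  exact norm_setIntegral_le_of_norm_le_const (measure_lt_top _ _) (hosc i hi)

/-- Convergence of integrals over `[0, u]` of uniformly convergent continuous integrands, with
respect to atomless measures which converge on compact subintervals of `[0, 1]`. -/
lemma tendsto_setIntegral_Icc_of_tendstoUniformlyOn {E : Type*} [NormedAddCommGroup E]
    [NormedSpace ℝ E] [CompleteSpace E] {μ : ℕ → Measure ℝ}
    {μ' : Measure ℝ} [∀ n, IsFiniteMeasure (μ n)] [∀ n, NullSingletonClass (μ n)] [IsFiniteMeasure μ']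
    [NullSingletonClass μ']
    (hμ : ∀ a b : ℝ, 0 ≤ a → a ≤ b → b ≤ 1 →
      Tendsto (fun n => (μ n).real (Icc a b)) atTop (𝓝 (μ'.real (Icc a b))))
    {f : ℕ → ℝ → E} {f' : ℝ → E} (hf : ∀ n, ContinuousOn (f n) (Icc 0 1))
    (hff' : TendstoUniformlyOn f f' atTop (Icc 0 1)) {u : ℝ} (hu : u ∈ Icc (0 : ℝ) 1) :
    Tendsto (fun n => ∫ v in Icc 0 u, f n v ∂(μ n)) atTop (𝓝 (∫ v in Icc 0 u, f' v ∂μ')) := by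
  have hf' : ContinuousOn f' (Icc 0 1) := hff'.continuousOn (Eventually.of_forall hf).frequently
  have hsub : Icc 0 u ⊆ Icc (0 : ℝ) 1 := Icc_subset_Icc_right hu.2
  set M := μ'.real (Icc 0 u) + 1
  have hM0 : 0 < M := by positivity
  have hmass : ∀ᶠ n in atTop, (μ n).real (Icc 0 u) ≤ M :=
    ((hμ 0 u le_rfl hu.1 hu.2).eventually_lt_const (lt_add_one _)).mono fun _ h => h.le
  refine Metric.tendsto_nhds.2 fun ε hε => ?_
  set η := ε / (4 * M) with hη
  have hη0 : 0 < η := by positivity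
  obtain ⟨δ, hδ, hosc⟩ := Metric.uniformContinuousOn_iff.1
    (isCompact_Icc.uniformContinuousOn_of_continuous hf') η hη0
  obtain ⟨N, hN⟩ := exists_nat_gt (1 / δ)
  have hN0 : (0 : ℝ) < N := (by positivity : 0 < 1 / δ).trans hN
  have hmesh : u / N < δ := by
    rw [div_lt_iff₀ hN0]
    rw [div_lt_iff₀ hδ] at hN
    nlinarith [hu.2]
  set t : ℕ → ℝ := fun i => i * (u / N) with ht_def
  have hstep : 0 ≤ u / N := div_nonneg hu.1 hN0.le
  have ht : Monotone t := fun i j hij => by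
    simp only [ht_def]; gcongr
  have ht0 : t 0 = 0 := by simp [ht_def]
  have htN : t N = u := by simp only [ht_def]; field_simp
  have htmem : ∀ i ≤ N, t i ∈ Icc (0 : ℝ) 1 := fun i hi =>
    ⟨ht0 ▸ ht (Nat.zero_le i), (ht hi).trans (htN ▸ hu.2)⟩
  have hcell : ∀ i < N, ∀ v ∈ Icc (t i) (t (i + 1)), ‖f' v - f' (t i)‖ ≤ η := by
    intro i hi v hv
    rw [← dist_eq_norm]
    refine (hosc v ⟨(htmem i hi.le).1.trans hv.1, hv.2.trans (htmem (i + 1) hi).2⟩ (t i)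
      (htmem i hi.le) ?_).le
    have : t (i + 1) = t i + u / N := by simp only [ht_def]; push_cast; ring
    rw [Real.dist_eq, abs_of_nonneg (sub_nonneg.2 hv.1)]
    linarith [hv.2]
  have hriem : ∀ (ν : Measure ℝ) [IsFiniteMeasure ν] [NullSingletonClass ν],
      dist (∫ v in Icc 0 u, f' v ∂ν)
        (∑ i ∈ Finset.range N, ν.real (Icc (t i) (t (i + 1))) • f' (t i))
        ≤ η * ν.real (Icc 0 u) := by
    intro ν _ _
    have := norm_integral_Icc_sub_riemannSum_le ν ht N (ε := η) (f := f')
      (by rw [ht0, htN]; exact hf'.mono hsub) hcell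
    rwa [ht0, htN, ← dist_eq_norm] at this
  have hsums : Tendsto
      (fun n => ∑ i ∈ Finset.range N, (μ n).real (Icc (t i) (t (i + 1))) • f' (t i)) atTop
      (𝓝 (∑ i ∈ Finset.range N, μ'.real (Icc (t i) (t (i + 1))) • f' (t i))) := by
    refine tendsto_finsetSum _ fun i hi => ?_
    rw [Finset.mem_range] at hi
    exact (hμ _ _ (htmem i hi.le).1 (ht i.le_succ) (htmem (i + 1) hi).2).smul_const _
  filter_upwards [hmass, Metric.tendsto_nhds.1 hsums (ε / 4) (by positivity),
    Metric.tendstoUniformlyOn_iff.1 hff' η hη0] with n hn hsn hfn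
  have hηM : η * M = ε / 4 := by rw [hη]; field_simp
  have h1 : dist (∫ v in Icc 0 u, f n v ∂(μ n)) (∫ v in Icc 0 u, f' v ∂(μ n)) ≤ ε / 4 := by
    rw [dist_eq_norm, ← integral_sub ((hf n).mono hsub |>.integrableOn_compact isCompact_Icc)
      (hf'.mono hsub |>.integrableOn_compact isCompact_Icc)]
    refine (norm_setIntegral_le_of_norm_le_const (measure_lt_top _ _) (C := η) fun v hv => ?_).trans
      ((mul_le_mul_of_nonneg_left hn hη0.le).trans hηM.le)
    rw [← dist_eq_norm, dist_comm]
    exact (hfn v (hsub hv)).le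
  have h2 := (hriem (μ n)).trans ((mul_le_mul_of_nonneg_left hn hη0.le).trans hηM.le)
  have h3 := (hriem μ').trans
    ((mul_le_mul_of_nonneg_left (lt_add_one _).le hη0.le).trans hηM.le)
  rw [dist_comm] at h3
  have h4 := dist_triangle4 (∫ v in Icc 0 u, f n v ∂(μ n)) (∫ v in Icc 0 u, f' v ∂(μ n))
    (∑ i ∈ Finset.range N, (μ n).real (Icc (t i) (t (i + 1))) • f' (t i))
    (∑ i ∈ Finset.range N, μ'.real (Icc (t i) (t (i + 1))) • f' (t i))
  have h5 := dist_triangle (∫ v in Icc 0 u, f n v ∂(μ n))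
    (∑ i ∈ Finset.range N, μ'.real (Icc (t i) (t (i + 1))) • f' (t i))
    (∫ v in Icc 0 u, f' v ∂μ')
  linarith

/-- Post-composition with a continuous map preserves uniform convergence when the limit is
continuous on a compact set. -/
lemma TendstoUniformlyOn.continuous_comp_of_isCompact {ι α β δ : Type*} [TopologicalSpace α]
    [UniformSpace β] [UniformSpace δ] {p : Filter ι} {F : ι → α → β} {f : α → β} {s : Set α}
    {G : β → δ} (hF : TendstoUniformlyOn F f p s) (hs : IsCompact s) (hf : ContinuousOn f s)
    (hG : Continuous G) :
    TendstoUniformlyOn (fun n => G ∘ F n) (G ∘ f) p s := by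
  intro r hr
  have h := (hs.image_of_continuousOn hf).uniformContinuousAt_of_continuousAt G
    (fun _ _ => hG.continuousAt) hr
  filter_upwards [hF _ h] with n hn x hx
  exact hn x hx (mem_image_of_mem f hx)

/-- stability of Stieltjes integral equations under uniform convergence. -/
theorem stmt9 (T : ℝ) (hT : 0 < T) (d l : ℕ)
    (γ : ℝ → (Fin d → ℝ) → (Fin l → ℝ) → Fin d → Fin l → ℝ)
    (hγ_cont : ContinuousOn (fun q : ℝ × (Fin d → ℝ) × (Fin l → ℝ) => γ q.1 q.2.1 q.2.2)
      (Set.Icc 0 T ×ˢ (Set.univ : Set ((Fin d → ℝ) × (Fin l → ℝ)))))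
    (hγ_bdd : ∃ C : ℝ, ∀ t ∈ Set.Icc (0:ℝ) T, ∀ x ξv i j, |γ t x ξv i j| ≤ C)
    (a : ℕ → ℝ → ℝ) (y : ℕ → ℝ → Fin d → ℝ) (z : ℕ → ℝ → Fin l → ℝ)
    (a' : ℝ → ℝ) (y' : ℝ → Fin d → ℝ) (z' : ℝ → Fin l → ℝ)
    (ha_cont : ∀ n, ContinuousOn (a n) (Set.Icc 0 1))
    (ha_mem : ∀ n, ∀ u ∈ Set.Icc (0:ℝ) 1, a n u ∈ Set.Icc 0 T)
    (hy_cont : ∀ n, ContinuousOn (y n) (Set.Icc 0 1))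
    (hz_cont : ∀ n, ContinuousOn (z n) (Set.Icc 0 1))
    (hz_mono : ∀ n j, MonotoneOn (fun u => z n u j) (Set.Icc 0 1))
    (μ : ℕ → Fin l → Measure ℝ)
    (hμ : ∀ n j, IsLSMeasureOn01 (fun u => z n u j) (μ n j))
    (heq : ∀ n, ∀ u ∈ Set.Icc (0:ℝ) 1,
      y n u = y n 0 + ∑ j, ∫ v in Set.Icc (0:ℝ) u, (fun i => γ (a n v) (y n v) (z n v) i j) ∂(μ n j))
    (hconv : TendstoUniformlyOn (fun n u => (a n u, y n u, z n u))
      (fun u => (a' u, y' u, z' u)) atTop (Set.Icc 0 1))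
    (μ' : Fin l → Measure ℝ)
    (hμ' : ∀ j, IsLSMeasureOn01 (fun u => z' u j) (μ' j)) :
    ∀ u ∈ Set.Icc (0:ℝ) 1,
      y' u = y' 0 + ∑ j, ∫ v in Set.Icc (0:ℝ) u, (fun i => γ (a' v) (y' v) (z' v) i j) ∂(μ' j) := by
  intro u hu
  have h0 : (0 : ℝ) ∈ Icc (0 : ℝ) 1 := ⟨le_rfl, zero_le_one⟩
  have hpt : ∀ v ∈ Icc (0 : ℝ) 1,
      Tendsto (fun n => (a n v, y n v, z n v)) atTop (𝓝 (a' v, y' v, z' v)) :=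
    fun v hv => hconv.tendsto_at hv
  have ha : ∀ v ∈ Icc (0 : ℝ) 1, a' v ∈ Icc 0 T := fun v hv =>
    isClosed_Icc.mem_of_tendsto (hpt v hv).fst_nhds (Eventually.of_forall fun n => ha_mem n v hv)
  have hy : ∀ v ∈ Icc (0 : ℝ) 1, Tendsto (fun n => y n v) atTop (𝓝 (y' v)) :=
    fun v hv => (hpt v hv).snd_nhds.fst_nhds
  have hz : ∀ j, ∀ v ∈ Icc (0 : ℝ) 1, Tendsto (fun n => z n v j) atTop (𝓝 (z' v j)) :=
    fun j v hv => tendsto_pi_nhds.1 (hpt v hv).snd_nhds.snd_nhds j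
  have hcont : ∀ n, ContinuousOn (fun v => (a n v, y n v, z n v)) (Icc 0 1) :=
    fun n => (ha_cont n).prodMk ((hy_cont n).prodMk (hz_cont n))
  have hcont' : ContinuousOn (fun v => (a' v, y' v, z' v)) (Icc 0 1) :=
    hconv.continuousOn (Eventually.of_forall hcont).frequently
  have hint : ∀ j, Tendsto
      (fun n => ∫ v in Icc (0 : ℝ) u, (fun i => γ (a n v) (y n v) (z n v) i j) ∂(μ n j)) atTop
      (𝓝 (∫ v in Icc (0 : ℝ) u, (fun i => γ (a' v) (y' v) (z' v) i j) ∂(μ' j))) := by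
    intro j
    have := fun n => (hμ n j).isFiniteMeasure
    have := fun n => (hμ n j).nullSingletonClass
    have := (hμ' j).isFiniteMeasure
    have := (hμ' j).nullSingletonClass
    let G : ℝ × (Fin d → ℝ) × (Fin l → ℝ) → Fin d → ℝ :=
      fun q i => γ (projIcc 0 T hT.le q.1) q.2.1 q.2.2 i j
    have hG : Continuous G := by
      have : Continuous fun q : ℝ × (Fin d → ℝ) × (Fin l → ℝ) =>
          γ (projIcc 0 T hT.le q.1) q.2.1 q.2.2 :=
        hγ_cont.comp_continuous
          (f := fun q : ℝ × (Fin d → ℝ) × (Fin l → ℝ) => ((projIcc 0 T hT.le q.1 : ℝ), q.2.1, q.2.2))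
          ((continuous_subtype_val.comp (continuous_projIcc.comp continuous_fst)).prodMk
            continuous_snd) fun q => ⟨(projIcc 0 T hT.le q.1).2, mem_univ _⟩
      exact continuous_pi fun i => (continuous_apply_apply i j).comp this
    have hGγ : ∀ s ∈ Icc 0 T, ∀ x w, G (s, x, w) = fun i => γ s x w i j := fun s hs x w => by
      simp only [G, projIcc_of_mem hT.le hs]
    have key := tendsto_setIntegral_Icc_of_tendstoUniformlyOn
      (fun b c hb hbc hc => IsLSMeasureOn01.tendsto_real_Icc (fun n => hμ n j) (hμ' j) (hz j)
        hb hbc hc)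
      (fun n => hG.comp_continuousOn (hcont n))
      (hconv.continuous_comp_of_isCompact isCompact_Icc hcont' hG) hu
    have hsub : Icc 0 u ⊆ Icc (0 : ℝ) 1 := Icc_subset_Icc_right hu.2
    convert key using 1
    · funext n
      exact setIntegral_congr_fun measurableSet_Icc fun v hv =>
        (hGγ _ (ha_mem n v (hsub hv)) _ _).symm
    · exact congrArg 𝓝 (setIntegral_congr_fun measurableSet_Icc fun v hv =>
        (hGγ _ (ha v (hsub hv)) _ _).symm)
  refine tendsto_nhds_unique (hy u hu) ?_
  simp_rw [fun n => heq n u hu]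
  exact (hy 0 h0).add (tendsto_finsetSum _ fun j _ => hint j)
end

section
/- Let (Ω,𝔉,ℙ) be a probability space, T>0, C>0, and let f:[0,T]×ℝ^d×ℝ^l→ℝ be continuous with |f(t,x,ξ)| ≤ C(1+|x|²+|ξ|²) for all (t,x,ξ). For each n∈ℕ let (X̄^n, ξ̄^n, r̄^n) and (X̄, ξ̄, r̄) be measurable maps from Ω into C([0,1]; ℝ^d×ℝ^l×[0,T]) such that almost surely every component of ξ̄^n, ξ̄ and the real-valued functions r̄^n, r̄ are non-decreasing. Assume (a) (X̄^n, ξ̄^n, r̄^n) → (X̄, ξ̄, r̄) uniformly on [0,1], ℙ-almost surely, and (b) the family ( sup_{u∈[0,1]}|X̄^n_u|² + sup_{u∈[0,1]}|ξ̄^n_u|² )_{n∈ℕ} is uniformly integrable. Then E[ ∫₀^1 f(r̄^n_u, X̄^n_u, ξ̄^n_u) dr̄^n_u ] → E[ ∫₀^1 f(r̄_u, X̄_u, ξ̄_u) dr̄_u ] as n→∞. -/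
open Set Filter MeasureTheory Topology

namespace IsLSMeasureOn01

variable {z : ℝ → ℝ} {μ : Measure ℝ}

theorem isFiniteMeasure_s12 (hμ : IsLSMeasureOn01 z μ) : IsFiniteMeasure μ := by
  refine ⟨?_⟩
  rw [← union_compl_self (Icc (0 : ℝ) 1)]
  refine (measure_union_le _ _).trans_lt ?_
  rw [hμ.2, hμ.1 0 1 le_rfl zero_le_one le_rfl, add_zero]
  exact ENNReal.ofReal_lt_top

theorem nullSingletonClass_s12 (hμ : IsLSMeasureOn01 z μ) : NullSingletonClass μ := by
  refine ⟨fun x => ?_⟩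
  by_cases hx : x ∈ Icc (0 : ℝ) 1
  · have := hμ.1 x x hx.1 le_rfl hx.2
    simpa using this
  · exact measure_mono_null (by simpa using hx) hμ.2

theorem measureReal_Icc (hμ : IsLSMeasureOn01 z μ) (hz : MonotoneOn z (Icc 0 1)) {a b : ℝ}
    (ha : 0 ≤ a) (hab : a ≤ b) (hb : b ≤ 1) : μ.real (Icc a b) = z b - z a := by
  rw [measureReal_def, hμ.1 a b ha hab hb, ENNReal.toReal_ofReal]
  exact sub_nonneg.2 (hz ⟨ha, hab.trans hb⟩ ⟨ha.trans hab, hb⟩ hab)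

theorem abs_setIntegral_Icc_sub_le (hμ : IsLSMeasureOn01 z μ) (hz : MonotoneOn z (Icc 0 1))
    {h : ℝ → ℝ} {a b c ε : ℝ} (ha : 0 ≤ a) (hab : a ≤ b) (hb : b ≤ 1)
    (hh : ContinuousOn h (Icc a b)) (hc : ∀ u ∈ Icc a b, |h u - c| ≤ ε) :
    |(∫ u in Icc a b, h u ∂μ) - c * (z b - z a)| ≤ ε * (z b - z a) := by
  have := hμ.isFiniteMeasure_s12
  have hi : IntegrableOn h (Icc a b) μ := hh.integrableOn_compact isCompact_Icc
  have key : (∫ u in Icc a b, (h u - c) ∂μ) = (∫ u in Icc a b, h u ∂μ) - c * (z b - z a) := by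
    rw [integral_sub hi (integrable_const c), setIntegral_const,
      hμ.measureReal_Icc hz ha hab hb, smul_eq_mul, mul_comm]
  rw [← key, ← hμ.measureReal_Icc hz ha hab hb]
  exact norm_setIntegral_le_of_norm_le_const (f := fun u => h u - c) (measure_lt_top _ _) hc

/-- Comparison of a Stieltjes integral with a Riemann–Stieltjes sum on a uniform grid. -/
theorem abs_setIntegral_sub_sum_le (hμ : IsLSMeasureOn01 z μ) (hz : MonotoneOn z (Icc 0 1))
    {h : ℝ → ℝ} (hh : ContinuousOn h (Icc 0 1)) {N : ℕ} (hN : 0 < N) {c : ℕ → ℝ} {ε : ℝ}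
    (hc : ∀ i < N, ∀ u ∈ Icc ((i : ℝ) / N) ((i + 1 : ℕ) / N), |h u - c i| ≤ ε) :
    |(∫ u in Icc (0 : ℝ) 1, h u ∂μ) -
      ∑ i ∈ Finset.range N, c i * (z ((i + 1 : ℕ) / N) - z ((i : ℝ) / N))| ≤ ε * (z 1 - z 0) := by
  have := hμ.isFiniteMeasure_s12
  have := hμ.nullSingletonClass_s12
  have hN' : (0 : ℝ) < N := by exact_mod_cast hN
  have h0 (i : ℕ) : 0 ≤ (i : ℝ) / N := by positivity
  have hle (i : ℕ) : (i : ℝ) / N ≤ (i + 1 : ℕ) / N := by gcongr; simp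
  have h1 (i : ℕ) (hi : i < N) : ((i + 1 : ℕ) : ℝ) / N ≤ 1 := by
    rw [div_le_one hN']; exact_mod_cast hi
  have hsub (i : ℕ) (hi : i < N) : Icc ((i : ℝ) / N) ((i + 1 : ℕ) / N) ⊆ Icc 0 1 :=
    Icc_subset_Icc (h0 i) (h1 i hi)
  have hsplit : ∫ u in Icc (0 : ℝ) 1, h u ∂μ =
      ∑ i ∈ Finset.range N, ∫ u in Icc ((i : ℝ) / N) ((i + 1 : ℕ) / N), h u ∂μ := by
    have key := intervalIntegral.sum_integral_adjacent_intervals (f := h) (μ := μ)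
      (a := fun i : ℕ => (i : ℝ) / N) (n := N) fun i hi =>
        (intervalIntegrable_iff_integrableOn_Icc_of_le (hle i)).2
          ((hh.mono (hsub i hi)).integrableOn_compact isCompact_Icc)
    simp only [Nat.cast_zero, zero_div, div_self hN'.ne'] at key
    rw [integral_Icc_eq_integral_Ioc, ← intervalIntegral.integral_of_le zero_le_one, ← key]
    refine Finset.sum_congr rfl fun i _ => ?_
    rw [intervalIntegral.integral_of_le (hle i), integral_Icc_eq_integral_Ioc]
  have htel : ∑ i ∈ Finset.range N, (z ((i + 1 : ℕ) / N) - z ((i : ℝ) / N)) = z 1 - z 0 := by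
    rw [Finset.sum_range_sub (fun i : ℕ => z ((i : ℝ) / N))]
    simp [div_self hN'.ne']
  rw [hsplit, ← Finset.sum_sub_distrib, ← htel, Finset.mul_sum]
  refine (Finset.abs_sum_le_sum_abs _ _).trans (Finset.sum_le_sum fun i hi => ?_)
  have hi := Finset.mem_range.1 hi
  exact hμ.abs_setIntegral_Icc_sub_le hz (h0 i) (hle i) (h1 i hi) (hh.mono (hsub i hi)) (hc i hi)

/-- If the integrands converge uniformly and the integrators converge pointwise, then the
Stieltjes integrals converge. -/
theorem tendsto_setIntegral {w : ℕ → ℝ → ℝ} {κ : ℕ → Measure ℝ} {g : ℕ → ℝ → ℝ} {h : ℝ → ℝ}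
    (hκ : ∀ n, IsLSMeasureOn01 (w n) (κ n)) (hμ : IsLSMeasureOn01 z μ)
    (hw : ∀ n, MonotoneOn (w n) (Icc 0 1)) (hz : MonotoneOn z (Icc 0 1))
    (hwz : ∀ u ∈ Icc (0 : ℝ) 1, Tendsto (fun n => w n u) atTop (𝓝 (z u)))
    (hg : ∀ n, ContinuousOn (g n) (Icc 0 1)) (hh : ContinuousOn h (Icc 0 1))
    (hgh : TendstoUniformlyOn g h atTop (Icc 0 1)) :
    Tendsto (fun n => ∫ u in Icc (0 : ℝ) 1, g n u ∂κ n) atTop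
      (𝓝 (∫ u in Icc (0 : ℝ) 1, h u ∂μ)) := by
  have h01 : (0 : ℝ) ∈ Icc (0 : ℝ) 1 := by simp
  have h11 : (1 : ℝ) ∈ Icc (0 : ℝ) 1 := by simp
  set A := z 1 - z 0
  have hA0 : 0 ≤ A := sub_nonneg.2 (hz h01 h11 zero_le_one)
  rw [Metric.tendsto_nhds]
  intro ε hε
  obtain ⟨η, hη, hηε⟩ : ∃ η > 0, 2 * η * (A + 1) + η * A + η < ε := by
    refine ⟨ε / (2 * (3 * A + 3)), by positivity, ?_⟩
    have : 2 * (ε / (2 * (3 * A + 3))) * (A + 1) + ε / (2 * (3 * A + 3)) * A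
        + ε / (2 * (3 * A + 3)) = ε / 2 := by
      field_simp
      ring
    linarith
  obtain ⟨δ, hδ, hosc⟩ := Metric.uniformContinuousOn_iff.1
    (isCompact_Icc.uniformContinuousOn_of_continuous hh) η hη
  obtain ⟨m, hm⟩ := exists_nat_one_div_lt hδ
  set N := m + 1 with hN
  have hN0 : 0 < N := m.succ_pos
  have hN' : (0 : ℝ) < N := by exact_mod_cast hN0
  have hgrid (i : ℕ) (hi : i ≤ N) : (i : ℝ) / N ∈ Icc (0 : ℝ) 1 :=
    ⟨by positivity, by rw [div_le_one hN']; exact_mod_cast hi⟩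
  have hmem (i : ℕ) (hi : i < N) : Icc ((i : ℝ) / N) ((i + 1 : ℕ) / N) ⊆ Icc 0 1 :=
    Icc_subset_Icc (hgrid i hi.le).1 (hgrid (i + 1) hi).2
  have hch (i : ℕ) (hi : i < N) (u : ℝ) (hu : u ∈ Icc ((i : ℝ) / N) ((i + 1 : ℕ) / N)) :
      |h u - h (i / N)| ≤ η := by
    refine (hosc u (hmem i hi hu) _ (hgrid i hi.le) ?_).le
    rw [Real.dist_eq, abs_of_nonneg (sub_nonneg.2 hu.1)]
    have h2 : ((i + 1 : ℕ) : ℝ) / N = i / N + 1 / N := by push_cast; ring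
    have h3 : (1 : ℝ) / N < δ := by rw [hN]; push_cast; exact hm
    linarith [hu.2]
  have hlim := hμ.abs_setIntegral_sub_sum_le hz hh hN0 (c := fun i => h (i / N)) hch
  have hsum : Tendsto (fun n => ∑ i ∈ Finset.range N,
      h (i / N) * (w n ((i + 1 : ℕ) / N) - w n ((i : ℝ) / N))) atTop
      (𝓝 (∑ i ∈ Finset.range N, h (i / N) * (z ((i + 1 : ℕ) / N) - z ((i : ℝ) / N)))) := by
    refine tendsto_finsetSum _ fun i hi => ?_
    have hi := Finset.mem_range.1 hi
    exact ((hwz _ (hgrid (i + 1) hi)).sub (hwz _ (hgrid i hi.le))).const_mul _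
  have hmass : Tendsto (fun n => w n 1 - w n 0) atTop (𝓝 A) := (hwz 1 h11).sub (hwz 0 h01)
  filter_upwards [Metric.tendsto_nhds.1 hsum η hη, hmass.eventually_lt_const (lt_add_one A),
    Metric.tendstoUniformlyOn_iff.1 hgh η hη] with n hn1 hn2 hn3
  have happrox := (hκ n).abs_setIntegral_sub_sum_le (hw n) (hg n) hN0
    (c := fun i => h (i / N)) (ε := 2 * η) fun i hi u hu => by
      have h1 := hn3 u (hmem i hi hu)
      rw [dist_comm, Real.dist_eq] at h1
      have h2 := hch i hi u hu
      have h3 := abs_sub_le (g n u) (h u) (h (i / N))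
      linarith
  have hb : 2 * η * (w n 1 - w n 0) ≤ 2 * η * (A + 1) := by gcongr
  rw [Real.dist_eq] at hn1 ⊢
  rw [abs_lt] at hn1 ⊢
  rw [abs_le] at happrox hlim
  constructor <;> linarith [happrox.1, happrox.2, hlim.1, hlim.2, hn1.1, hn1.2]

end IsLSMeasureOn01

/-- Uniform convergence is preserved by composition with a function that is continuous on a closed
set containing the values, when the limit is continuous on a compact set. -/
theorem ContinuousOn.comp_tendstoUniformlyOn_of_isCompact {α β E F : Type*} [TopologicalSpace α]
    [PseudoMetricSpace E] [ProperSpace E] [UniformSpace F] {φ : E → F} {S : Set E}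
    (hS : IsClosed S) (hφ : ContinuousOn φ S) {K : Set α} (hK : IsCompact K) {p : Filter β}
    {q : β → α → E} {q' : α → E} (hqS : ∀ n, ∀ u ∈ K, q n u ∈ S) (hqS' : ∀ u ∈ K, q' u ∈ S)
    (hq' : ContinuousOn q' K) (hq : TendstoUniformlyOn q q' p K) :
    TendstoUniformlyOn (fun n => φ ∘ q n) (φ ∘ q') p K := by
  have hB : IsCompact (Metric.cthickening 1 (q' '' K)) := (hK.image_of_continuousOn hq').cthickening
  have hu := (hB.inter_right hS).uniformContinuousOn_of_continuous (hφ.mono inter_subset_right)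
  refine hu.comp_tendstoUniformlyOn_eventually ?_ (fun u hu => ?_) hq
  · filter_upwards [Metric.tendstoUniformlyOn_iff.1 hq 1 one_pos] with n hn u hu
    refine ⟨Metric.mem_cthickening_of_dist_le _ (q' u) _ _ (mem_image_of_mem _ hu) ?_, hqS n u hu⟩
    rw [dist_comm]
    exact (hn u hu).le
  · exact ⟨Metric.self_subset_cthickening _ (mem_image_of_mem _ hu), hqS' u hu⟩

/-- A family dominated by a uniformly integrable family is uniformly integrable. -/
theorem MeasureTheory.UnifIntegrable.mono_norm {ι α β γ : Type*} {_ : MeasurableSpace α}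
    {μ : Measure α} [NormedAddCommGroup β] [NormedAddCommGroup γ] {p : ENNReal}
    {f : ι → α → β} {g : ι → α → γ} (hg : UnifIntegrable g p μ)
    (hfg : ∀ i, ∀ᵐ x ∂μ, ‖f i x‖ ≤ ‖g i x‖) : UnifIntegrable f p μ := by
  intro ε hε
  obtain ⟨δ, hδ, h⟩ := hg hε
  refine ⟨δ, hδ, fun i s hs hμs => le_trans (eLpNorm_mono_ae ?_) (h i s hs hμs)⟩
  filter_upwards [hfg i] with x hx
  by_cases hxs : x ∈ s <;> simp [hxs, hx]

theorem MeasureTheory.UnifIntegrable.const_smul_real {ι α β : Type*} {_ : MeasurableSpace α}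
    {μ : Measure α} [NormedAddCommGroup β] [NormedSpace ℝ β] {p : ENNReal}
    {f : ι → α → β} (hf : UnifIntegrable f p μ) (c : ℝ) :
    UnifIntegrable (fun i => c • f i) p μ := by
  intro ε hε
  obtain ⟨δ, hδ, h⟩ := hf (ε := ε / (|c| + 1)) (by positivity)
  refine ⟨δ, hδ, fun i s hs hμs => ?_⟩
  have hind : s.indicator (c • f i) = c • s.indicator (f i) := indicator_const_smul s c (f i)
  calc eLpNorm (s.indicator (c • f i)) p μ
      = eLpNorm (c • s.indicator (f i)) p μ := by rw [hind]
    _ ≤ ‖c‖ₑ * eLpNorm (s.indicator (f i)) p μ := eLpNorm_const_smul_le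
    _ ≤ ENNReal.ofReal |c| * ENNReal.ofReal (ε / (|c| + 1)) := by
        rw [← Real.enorm_eq_ofReal_abs]
        gcongr
        exact h i s hs hμs
    _ = ENNReal.ofReal (|c| * (ε / (|c| + 1))) := (ENNReal.ofReal_mul (abs_nonneg c)).symm
    _ ≤ ENNReal.ofReal ε := by
        refine ENNReal.ofReal_le_ofReal ?_
        rw [mul_div_assoc', div_le_iff₀ (by positivity)]
        nlinarith [abs_nonneg c]

theorem continuous_eucNorm {ι : Type*} [Fintype ι] : Continuous (eucNorm : (ι → ℝ) → ℝ) := by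
  unfold eucNorm
  fun_prop

theorem eucNorm_sq_le_iSup {ι : Type*} [Fintype ι] {Y : ℝ → ι → ℝ}
    (hY : ContinuousOn Y (Icc 0 1)) {u : ℝ} (hu : u ∈ Icc (0 : ℝ) 1) :
    eucNorm (Y u) ^ 2 ≤ ⨆ v : Icc (0 : ℝ) 1, eucNorm (Y v.1) ^ 2 := by
  have hbdd : BddAbove (range fun v : Icc (0 : ℝ) 1 => eucNorm (Y v.1) ^ 2) :=
    (isCompact_range ((continuous_eucNorm.comp hY.domRestrict).pow 2)).bddAbove
  exact le_ciSup hbdd ⟨u, hu⟩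

/-- convergence of the expected running reward term
`E[∫₀¹ f(r̄ⁿ_u, X̄ⁿ_u, ξ̄ⁿ_u) dr̄ⁿ_u]`. -/
theorem stmt12 {Ω : Type*} [MeasurableSpace Ω] (P : Measure Ω) [IsProbabilityMeasure P]
    (T C : ℝ) (hT : 0 < T) (hC : 0 < C) (d l : ℕ)
    (f : ℝ → (Fin d → ℝ) → (Fin l → ℝ) → ℝ)
    (hf_cont : ContinuousOn (fun q : ℝ × (Fin d → ℝ) × (Fin l → ℝ) => f q.1 q.2.1 q.2.2)
      (Set.Icc 0 T ×ˢ (Set.univ : Set ((Fin d → ℝ) × (Fin l → ℝ)))))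
    (hf_growth : ∀ t ∈ Set.Icc (0:ℝ) T, ∀ x ξv,
      |f t x ξv| ≤ C * (1 + eucNorm x ^ 2 + eucNorm ξv ^ 2))
    (X : ℕ → Ω → ℝ → Fin d → ℝ) (ξ : ℕ → Ω → ℝ → Fin l → ℝ) (r : ℕ → Ω → ℝ → ℝ)
    (X' : Ω → ℝ → Fin d → ℝ) (ξ' : Ω → ℝ → Fin l → ℝ) (r' : Ω → ℝ → ℝ)
    (hcont : ∀ n ω, ContinuousOn (X n ω) (Set.Icc 0 1) ∧ ContinuousOn (ξ n ω) (Set.Icc 0 1) ∧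
      ContinuousOn (r n ω) (Set.Icc 0 1))
    (hcont' : ∀ ω, ContinuousOn (X' ω) (Set.Icc 0 1) ∧ ContinuousOn (ξ' ω) (Set.Icc 0 1) ∧
      ContinuousOn (r' ω) (Set.Icc 0 1))
    (hrT : ∀ n ω, ∀ u ∈ Set.Icc (0:ℝ) 1, r n ω u ∈ Set.Icc 0 T)
    (hrT' : ∀ ω, ∀ u ∈ Set.Icc (0:ℝ) 1, r' ω u ∈ Set.Icc 0 T)
    -- almost surely, all components of `ξⁿ, ξ` and the time scales `rⁿ, r` are non-decreasing
    (hmono : ∀ᵐ ω ∂P, (∀ n j, MonotoneOn (fun u => ξ n ω u j) (Set.Icc 0 1)) ∧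
      (∀ j, MonotoneOn (fun u => ξ' ω u j) (Set.Icc 0 1)) ∧
      (∀ n, MonotoneOn (r n ω) (Set.Icc 0 1)) ∧ MonotoneOn (r' ω) (Set.Icc 0 1))
    (ν : ℕ → Ω → Measure ℝ) (ν' : Ω → Measure ℝ)
    (hν : ∀ n ω, IsLSMeasureOn01 (r n ω) (ν n ω))
    (hν' : ∀ ω, IsLSMeasureOn01 (r' ω) (ν' ω))
    -- (a) almost sure uniform convergence on [0,1]
    (hconv : ∀ᵐ ω ∂P, TendstoUniformlyOn (fun n u => (X n ω u, ξ n ω u, r n ω u))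
      (fun u => (X' ω u, ξ' ω u, r' ω u)) atTop (Set.Icc 0 1))
    -- (b) uniform integrability
    (hUI : UniformIntegrable (fun n ω =>
      (⨆ u : Set.Icc (0:ℝ) 1, eucNorm (X n ω u.1) ^ 2) +
        ⨆ u : Set.Icc (0:ℝ) 1, eucNorm (ξ n ω u.1) ^ 2) 1 P)
    (hint : ∀ n, Integrable (fun ω =>
      ∫ u in Set.Icc (0:ℝ) 1, f (r n ω u) (X n ω u) (ξ n ω u) ∂(ν n ω)) P)
    (hint' : Integrable (fun ω =>
      ∫ u in Set.Icc (0:ℝ) 1, f (r' ω u) (X' ω u) (ξ' ω u) ∂(ν' ω)) P) :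
    Tendsto (fun n => ∫ ω,
        (∫ u in Set.Icc (0:ℝ) 1, f (r n ω u) (X n ω u) (ξ n ω u) ∂(ν n ω)) ∂P)
      atTop (𝓝 (∫ ω,
        (∫ u in Set.Icc (0:ℝ) 1, f (r' ω u) (X' ω u) (ξ' ω u) ∂(ν' ω)) ∂P)) := by
  have hpath {x : ℝ → Fin d → ℝ} {y : ℝ → Fin l → ℝ} {s : ℝ → ℝ} (hx : ContinuousOn x (Icc 0 1))
      (hy : ContinuousOn y (Icc 0 1)) (hs : ContinuousOn s (Icc 0 1))
      (hsT : ∀ u ∈ Icc (0 : ℝ) 1, s u ∈ Icc 0 T) :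
      ContinuousOn (fun u => f (s u) (x u) (y u)) (Icc 0 1) :=
    hf_cont.comp (hs.prodMk (hx.prodMk hy)) fun u hu => ⟨hsT u hu, mem_univ _⟩
  have hae : ∀ᵐ ω ∂P, Tendsto
      (fun n => ∫ u in Icc (0 : ℝ) 1, f (r n ω u) (X n ω u) (ξ n ω u) ∂(ν n ω)) atTop
      (𝓝 (∫ u in Icc (0 : ℝ) 1, f (r' ω u) (X' ω u) (ξ' ω u) ∂(ν' ω))) := by
    filter_upwards [hmono, hconv] with ω hm hω
    obtain ⟨hX, hξ, hr⟩ := hcont' ω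
    have hperm : UniformContinuous
        (fun q : (Fin d → ℝ) × (Fin l → ℝ) × ℝ => (q.2.2, q.1, q.2.1)) := by
      fun_prop
    have hq := hperm.comp_tendstoUniformlyOn hω
    refine IsLSMeasureOn01.tendsto_setIntegral (fun n => hν n ω) (hν' ω) hm.2.2.1 hm.2.2.2
      (fun u hu => ?_) (fun n => ?_) (hpath hX hξ hr (hrT' ω)) ?_
    · exact (continuous_fst.tendsto _).comp (hq.tendsto_at hu)
    · exact hpath (hcont n ω).1 (hcont n ω).2.1 (hcont n ω).2.2 (hrT n ω)
    · exact hf_cont.comp_tendstoUniformlyOn_of_isCompact (isClosed_Icc.prod isClosed_univ)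
        isCompact_Icc (fun n u hu => ⟨hrT n ω u hu, mem_univ _⟩)
        (fun u hu => ⟨hrT' ω u hu, mem_univ _⟩) (hr.prodMk (hX.prodMk hξ)) hq
  have hbound (n : ℕ) : ∀ᵐ ω ∂P,
      ‖∫ u in Icc (0 : ℝ) 1, f (r n ω u) (X n ω u) (ξ n ω u) ∂(ν n ω)‖ ≤
      C * T * (1 + ((⨆ u : Icc (0 : ℝ) 1, eucNorm (X n ω u.1) ^ 2) +
        ⨆ u : Icc (0 : ℝ) 1, eucNorm (ξ n ω u.1) ^ 2)) := by
    filter_upwards [hmono] with ω hm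
    have := (hν n ω).isFiniteMeasure_s12
    have h01 : (0 : ℝ) ∈ Icc (0 : ℝ) 1 := by simp
    have h11 : (1 : ℝ) ∈ Icc (0 : ℝ) 1 := by simp
    set S₁ := ⨆ u : Icc (0 : ℝ) 1, eucNorm (X n ω u.1) ^ 2
    set S₂ := ⨆ u : Icc (0 : ℝ) 1, eucNorm (ξ n ω u.1) ^ 2
    have hS₁ : 0 ≤ S₁ := Real.iSup_nonneg fun u => sq_nonneg _
    have hS₂ : 0 ≤ S₂ := Real.iSup_nonneg fun u => sq_nonneg _
    calc _ ≤ C * (1 + S₁ + S₂) * (ν n ω).real (Icc 0 1) := by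
          refine norm_setIntegral_le_of_norm_le_const (measure_lt_top _ _) fun u hu => ?_
          refine (hf_growth _ (hrT n ω u hu) _ _).trans ?_
          gcongr
          · exact eucNorm_sq_le_iSup (hcont n ω).1 hu
          · exact eucNorm_sq_le_iSup (hcont n ω).2.1 hu
      _ ≤ C * (1 + S₁ + S₂) * T := by
          rw [(hν n ω).measureReal_Icc (hm.2.2.1 n) le_rfl zero_le_one le_rfl]
          gcongr
          linarith [(hrT n ω 1 h11).2, (hrT n ω 0 h01).1]
      _ = C * T * (1 + (S₁ + S₂)) := by ring
  have hdom := ((unifIntegrable_const (ι := ℕ) le_rfl ENNReal.one_ne_top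
    (memLp_const (μ := P) (1 : ℝ))).add hUI.unifIntegrable le_rfl
    (fun _ => aestronglyMeasurable_const) hUI.aestronglyMeasurable).const_smul_real (C * T)
  have hui := hdom.mono_norm fun n => (hbound n).mono fun ω hω => hω.trans (Real.le_norm_self _)
  exact tendsto_integral_of_L1' _ hint'.aestronglyMeasurable
    (Eventually.of_forall hint) (tendsto_Lp_finite_of_tendsto_ae le_rfl ENNReal.one_ne_top
      (fun n => (hint n).aestronglyMeasurable) (memLp_one_iff_integrable.2 hint') hui hae)
end
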